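/- Let u be a C³ solution of div(∇u/√(1+|∇u|²)) + f(u) = 0 in Ω ⊂ ℝⁿ and P = F(u) - (1+|∇u|²)^{-1/2} with F' = f. Then at every point where ∇u ≠ 0, P satisfies the differential inequality (1+|∇u|²)ΔP - u_i u_j P_{ij} + b^i P_i ≥ 0, where b^i = (1+|∇u|²)^{1/2}(1+|∇u|²+|∇u|^{-2}) f(u) u_i + (1-|∇u|^{-2}) u_j u_{ij}. In particular P is a subsolution of a (degenerate) elliptic equation away from critical points of u. -/

import Mathlib

noncomputable section

/-- Partial derivative `u_i` of `u : ℝⁿ → ℝ` in the `i`-th coordinate direction. -/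
noncomputable def pd {n : ℕ} (u : EuclideanSpace ℝ (Fin n) → ℝ) (i : Fin n)
    (x : EuclideanSpace ℝ (Fin n)) : ℝ :=
  fderiv ℝ u x (EuclideanSpace.single i 1)

/-- `|∇u(x)|²`. -/
noncomputable def gradSq {n : ℕ} (u : EuclideanSpace ℝ (Fin n) → ℝ)
    (x : EuclideanSpace ℝ (Fin n)) : ℝ :=
  ∑ i, (pd u i x) ^ 2

/-- The minimal-surface/mean-curvature operator `div(∇u/√(1+|∇u|²))`. -/
noncomputable def mcOp {n : ℕ} (u : EuclideanSpace ℝ (Fin n) → ℝ)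
    (x : EuclideanSpace ℝ (Fin n)) : ℝ :=
  ∑ i, pd (fun y => pd u i y / Real.sqrt (1 + gradSq u y)) i x

/-- The P-function `P(x) = F(u(x)) - (1+|∇u(x)|²)^{-1/2}`. -/
noncomputable def Pfun {n : ℕ} (F : ℝ → ℝ) (u : EuclideanSpace ℝ (Fin n) → ℝ)
    (x : EuclideanSpace ℝ (Fin n)) : ℝ :=
  F (u x) - 1 / Real.sqrt (1 + gradSq u x)

/-- The unit vector in the `i`-th coordinate direction. -/
abbrev coordDir {n : ℕ} (i : Fin n) : EuclideanSpace ℝ (Fin n) := EuclideanSpace.single i 1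

section Calculus

variable {n : ℕ} {g : EuclideanSpace ℝ (Fin n) → ℝ} {x : EuclideanSpace ℝ (Fin n)} {i j k : Fin n}

lemma hasLineDerivAt_pd (hg : DifferentiableAt ℝ g x) (i : Fin n) :
    HasLineDerivAt ℝ g (pd g i x) x (coordDir i) :=
  hg.hasFDerivAt.hasLineDerivAt _

lemma pd_eq_of_hasLineDerivAt {d : ℝ} (hg : DifferentiableAt ℝ g x)
    (h : HasLineDerivAt ℝ g d x (coordDir i)) : pd g i x = d :=
  (hasLineDerivAt_pd hg i).unique h

lemma differentiableAt_quotient {g' : EuclideanSpace ℝ (Fin n) → ℝ} (hg : DifferentiableAt ℝ g x)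
    (hg' : DifferentiableAt ℝ g' x) (h : g' x ≠ 0) :
    DifferentiableAt ℝ (fun y => g y / g' y) x := by
  simpa only [div_eq_mul_inv] using hg.fun_mul (hg'.fun_inv h)

lemma pd_congr {g' : EuclideanSpace ℝ (Fin n) → ℝ} (h : g =ᶠ[nhds x] g') :
    pd g i x = pd g' i x := by
  simp only [pd, h.fderiv_eq]

lemma contDiffOn_pd {Ω : Set (EuclideanSpace ℝ (Fin n))} {m m' : WithTop ℕ∞} (hΩ : IsOpen Ω)
    (hg : ContDiffOn ℝ m' g Ω) (h : m + 1 ≤ m') (i : Fin n) : ContDiffOn ℝ m (pd g i) Ω :=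
  (hg.fderiv_of_isOpen hΩ h).clm_apply contDiffOn_const

lemma pd_comm {Ω : Set (EuclideanSpace ℝ (Fin n))} (hΩ : IsOpen Ω)
    (hg : ContDiffOn ℝ 2 g Ω) (hx : x ∈ Ω) : pd (pd g i) j x = pd (pd g j) i x := by
  have hsymm := (hg.contDiffAt (hΩ.mem_nhds hx)).isSymmSndFDerivAt (by simp)
  have hd : DifferentiableAt ℝ (fderiv ℝ g) x :=
    ((hg.fderiv_of_isOpen (m := 1) hΩ (by norm_num)).differentiableOn (by norm_num)).differentiableAt
      (hΩ.mem_nhds hx)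
  have key (a b : Fin n) : pd (pd g a) b x = fderiv ℝ (fderiv ℝ g) x (coordDir b) (coordDir a) := by
    have := hd.hasFDerivAt.clm_apply (hasFDerivAt_const (coordDir a) x)
    rw [pd, show pd g a = fun y => fderiv ℝ g y (coordDir a) from rfl, this.fderiv]
    simp
  rw [key, key, hsymm.eq]

end Calculus

section Algebra

variable {ι : Type*} [Fintype ι] {p : ι → ℝ} {H : ι → ι → ℝ} {T : ι → ι → ι → ℝ}

lemma sum_mul_gram (hH : ∀ i j, H i j = H j i) :
    ∑ i, ∑ j, p i * p j * ∑ k, H k j * H k i = ∑ i, (∑ k, p k * H k i) ^ 2 := by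
  simp_rw [sq, Finset.sum_mul_sum, Finset.mul_sum]
  calc _ = ∑ i, ∑ k, ∑ j, p i * p j * (H k j * H k i) :=
        Finset.sum_congr rfl fun i _ => Finset.sum_comm
    _ = ∑ k, ∑ i, ∑ j, p i * p j * (H k j * H k i) := Finset.sum_comm
    _ = _ := by
        refine Finset.sum_congr rfl fun k _ => Finset.sum_congr rfl fun i _ =>
          Finset.sum_congr rfl fun j _ => ?_
        rw [hH k j, hH k i]; ring

lemma sum_sq_mulVec_le :
    ∑ i, (∑ k, p k * H k i) ^ 2 ≤ (∑ i, p i ^ 2) * ∑ i, ∑ k, H k i * H k i := by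
  rw [Finset.mul_sum]
  refine Finset.sum_le_sum fun i _ => ?_
  simpa only [sq] using Finset.sum_mul_sq_le_sq_mul_sq Finset.univ p (fun k => H k i)

/-- The algebraic heart of the inequality: `h` stands for `D²u ∇u`, `M` for `(D²u)²`, `R` for the
third derivatives contracted with `∇u`, and `D` for `∇Δu`. -/
lemma elliptic_inequality_of_contractions {p h D : ι → ℝ} {H M R : ι → ι → ℝ} {a a' w : ℝ}
    (hw : 0 < w) (hw2 : w ^ 2 = 1 + ∑ i, p i ^ 2) (hq : ∑ i, p i ^ 2 ≠ 0)
    (hs : ∑ i, ∑ j, p i * p j * H i j = ∑ i, p i * h i)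
    (hgram : ∑ i, ∑ j, p i * p j * M i j = ∑ i, h i ^ 2)
    (hgram' : ∑ k, p k * ∑ i, p i * M i k = ∑ i, h i ^ 2)
    (hCS : ∑ i, h i ^ 2 ≤ (∑ i, p i ^ 2) * ∑ i, M i i)
    (hD : ∑ k, p k * D k = ∑ i, R i i)
    (hHh : ∑ k, p k * ∑ i, H i k * h i = ∑ i, h i ^ 2)
    (hPDE : w ^ 2 * ∑ i, H i i - ∑ i, p i * h i + a * w ^ 3 = 0)
    (hdPDE : ∀ k, 2 * h k * ∑ i, H i i + w ^ 2 * D k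
      - ∑ i, (H i k * h i + p i * (M i k + R i k))
      + (a' * p k * w ^ 3 + a * (3 * w * h k)) = 0) :
    0 ≤ w ^ 2 * (∑ i, (a' * p i * p i + a * H i i + (M i i + R i i) / w ^ 3
            - 3 * h i * h i / w ^ 5))
        - (∑ i, ∑ j, p i * p j * (a' * p i * p j + a * H i j + (M i j + R i j) / w ^ 3
            - 3 * h i * h j / w ^ 5))
        + ∑ i, (w * (w ^ 2 + (∑ i, p i ^ 2)⁻¹) * a * p i + (1 - (∑ i, p i ^ 2)⁻¹) * h i)
            * (a * p i + h i / w ^ 3) := by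
  have hdiff := Finset.sum_congr rfl fun k (_ : k ∈ Finset.univ) => congrArg (p k * ·) (hdPDE k)
  have hq0 : 0 ≤ ∑ i, p i ^ 2 := Finset.sum_nonneg fun i _ => sq_nonneg _
  have htrace (L : ℝ) (hL : L = ∑ i, H i i) :
      ∑ i, (a' * p i * p i + a * H i i + (M i i + R i i) / w ^ 3 - 3 * h i * h i / w ^ 5)
      = a' * (∑ i, p i ^ 2) + a * L + ((∑ i, M i i) + ∑ i, R i i) / w ^ 3
        - 3 * (∑ i, h i ^ 2) / w ^ 5 := by
    simp_rw [hL, Finset.mul_sum, ← Finset.sum_add_distrib, Finset.sum_div,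
      ← Finset.sum_add_distrib, ← Finset.sum_sub_distrib]
    exact Finset.sum_congr rfl fun i _ => by ring
  have hquad : ∑ i, ∑ j, p i * p j * (a' * p i * p j + a * H i j + (M i j + R i j) / w ^ 3
        - 3 * h i * h j / w ^ 5)
      = a' * (∑ i, p i ^ 2) ^ 2 + a * (∑ i, p i * h i)
        + ((∑ i, h i ^ 2) + ∑ i, ∑ j, p i * p j * R i j) / w ^ 3
        - 3 * (∑ i, p i * h i) ^ 2 / w ^ 5 := by
    rw [← hgram, sq (∑ i, p i ^ 2), sq (∑ i, p i * h i), Finset.sum_mul_sum, Finset.sum_mul_sum,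
      ← hs]
    simp_rw [Finset.mul_sum, ← Finset.sum_add_distrib, Finset.sum_div,
      ← Finset.sum_add_distrib, ← Finset.sum_sub_distrib]
    exact Finset.sum_congr rfl fun i _ => Finset.sum_congr rfl fun j _ => by ring
  have hgrad (r : ℝ) :
      ∑ i, (w * (w ^ 2 + r) * a * p i + (1 - r) * h i) * (a * p i + h i / w ^ 3)
      = w * (w ^ 2 + r) * a * (a * (∑ i, p i ^ 2) + (∑ i, p i * h i) / w ^ 3)
        + (1 - r) * (a * (∑ i, p i * h i) + (∑ i, h i ^ 2) / w ^ 3) := by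
    simp_rw [Finset.mul_sum, Finset.sum_div, ← Finset.sum_add_distrib, Finset.mul_sum,
      ← Finset.sum_add_distrib]
    exact Finset.sum_congr rfl fun i _ => by ring
  have hR : ∑ k, p k * ∑ i, p i * R i k = ∑ i, ∑ j, p i * p j * R i j := by
    simp_rw [Finset.mul_sum]
    rw [Finset.sum_comm]
    exact Finset.sum_congr rfl fun i _ => Finset.sum_congr rfl fun j _ => by ring
  have hdiff' : 2 * (∑ i, p i * h i) * (∑ i, H i i) + w ^ 2 * (∑ i, R i i)
      - 2 * (∑ i, h i ^ 2) - (∑ i, ∑ j, p i * p j * R i j)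
      + a' * (∑ i, p i ^ 2) * w ^ 3 + 3 * a * w * (∑ i, p i * h i) = 0 := by
    simp only [mul_zero, Finset.sum_const_zero] at hdiff
    rw [← hdiff]
    have key (L : ℝ) (k : ι) : p k * (2 * h k * L + w ^ 2 * D k
        - ∑ i, (H i k * h i + p i * (M i k + R i k))
        + (a' * p k * w ^ 3 + a * (3 * w * h k)))
      = (2 * L + 3 * a * w) * (p k * h k) + w ^ 2 * (p k * D k) - p k * ∑ i, H i k * h i
        - p k * ∑ i, p i * M i k - p k * ∑ i, p i * R i k + a' * w ^ 3 * p k ^ 2 := by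
      simp_rw [mul_add (p _) (M _ _), Finset.sum_add_distrib]
      ring
    simp_rw [key, Finset.sum_add_distrib, Finset.sum_sub_distrib, Finset.sum_add_distrib,
      ← Finset.mul_sum]
    rw [hHh, hgram', hR, hD]
    ring
  rw [htrace _ rfl, hquad, hgrad]
  generalize ∑ i, ∑ j, p i * p j * R i j = B at *
  generalize ∑ i, R i i = A at *
  generalize ∑ i, H i i = L at *
  generalize ∑ i, M i i = K at *
  generalize ∑ i, p i * h i = s at *
  generalize ∑ i, h i ^ 2 = N at *
  generalize ∑ i, p i ^ 2 = q at *
  have hqpos : 0 < q := lt_of_le_of_ne hq0 (Ne.symm hq)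
  have hL : L = (s - a * w ^ 3) / w ^ 2 := by
    field_simp
    linarith
  have hB : B = 2 * s * L + w ^ 2 * A - 2 * N + a' * q * w ^ 3 + 3 * a * w * s := by linarith
  have hnonneg : 0 ≤ (q * K - N) / (q * w) + w * (q * a + s / w ^ 3) ^ 2 :=
    add_nonneg (div_nonneg (by linarith) (by positivity)) (by positivity)
  convert hnonneg using 1
  have hqw : q = w ^ 2 - 1 := by linarith
  rw [hB, hL]
  field_simp
  rw [hqw]
  ring

/-- The pointwise algebraic form of the differential inequality: `p`, `H`, `T` are the first, second
and third derivatives of `u`, and `a` and its primed version the values of `f` and its derivative. -/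
lemma elliptic_inequality_of_derivatives {a a' w : ℝ} (hw : 0 < w)
    (hw2 : w ^ 2 = 1 + ∑ i, p i ^ 2) (hq : ∑ i, p i ^ 2 ≠ 0)
    (hH : ∀ i j, H i j = H j i) (hT₁ : ∀ i j k, T i j k = T j i k)
    (hT₂ : ∀ i j k, T i j k = T i k j)
    (hPDE : w ^ 2 * ∑ i, H i i - ∑ i, p i * ∑ k, p k * H k i + a * w ^ 3 = 0)
    (hdPDE : ∀ k, 2 * (∑ l, p l * H l k) * ∑ i, H i i + w ^ 2 * ∑ i, T i i k
      - ∑ i, (H i k * (∑ l, p l * H l i) + p i * ∑ l, (H l k * H l i + p l * T l i k))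
      + (a' * p k * w ^ 3 + a * (3 * w * ∑ l, p l * H l k)) = 0) :
    0 ≤ w ^ 2 * (∑ i, (a' * p i * p i + a * H i i
            + (∑ k, (H k i * H k i + p k * T k i i)) / w ^ 3
            - 3 * (∑ k, p k * H k i) * (∑ k, p k * H k i) / w ^ 5))
        - (∑ i, ∑ j, p i * p j * (a' * p i * p j + a * H i j
            + (∑ k, (H k j * H k i + p k * T k i j)) / w ^ 3
            - 3 * (∑ k, p k * H k i) * (∑ k, p k * H k j) / w ^ 5))
        + ∑ i, (w * (w ^ 2 + (∑ i, p i ^ 2)⁻¹) * a * p i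
              + (1 - (∑ i, p i ^ 2)⁻¹) * ∑ j, p j * H i j)
            * (a * p i + (∑ k, p k * H k i) / w ^ 3) := by
  have hsymm (i : ι) : ∑ j, p j * H i j = ∑ k, p k * H k i :=
    Finset.sum_congr rfl fun j _ => by rw [hH]
  have hs : ∑ i, ∑ j, p i * p j * H i j = ∑ i, p i * ∑ k, p k * H k i := by
    refine Finset.sum_congr rfl fun i _ => ?_
    rw [← hsymm, Finset.mul_sum]
    exact Finset.sum_congr rfl fun j _ => by ring
  have hD : ∑ k, p k * ∑ i, T i i k = ∑ i, ∑ k, p k * T k i i := by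
    simp_rw [Finset.mul_sum]
    rw [Finset.sum_comm]
    exact Finset.sum_congr rfl fun i _ => Finset.sum_congr rfl fun k _ => by
      rw [hT₂ i i k, hT₁ i k i]
  have hHh : ∑ k, p k * ∑ i, H i k * (∑ l, p l * H l i) = ∑ i, (∑ l, p l * H l i) ^ 2 := by
    simp_rw [Finset.mul_sum (Finset.univ) _ (p _)]
    rw [Finset.sum_comm]
    refine Finset.sum_congr rfl fun i _ => ?_
    rw [sq, ← hsymm, Finset.sum_mul]
    exact Finset.sum_congr rfl fun k _ => by ring
  have hgram' : ∑ k, p k * ∑ i, p i * ∑ l, H l k * H l i = ∑ i, (∑ l, p l * H l i) ^ 2 := by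
    rw [← sum_mul_gram hH]
    simp_rw [Finset.mul_sum]
    rw [Finset.sum_comm]
    exact Finset.sum_congr rfl fun i _ => Finset.sum_congr rfl fun j _ =>
      Finset.sum_congr rfl fun k _ => by ring
  simp_rw [hsymm]
  simp only [Finset.sum_add_distrib (f := fun k => H k _ * H k _)] at hdPDE ⊢
  exact elliptic_inequality_of_contractions (h := fun i => ∑ k, p k * H k i)
    (M := fun i j => ∑ k, H k j * H k i) (R := fun i j => ∑ k, p k * T k i j)
    (D := fun k => ∑ i, T i i k) hw hw2 hq hs (sum_mul_gram hH) hgram' sum_sq_mulVec_le hD hHh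
    hPDE hdPDE

end Algebra

section PFunction

variable {n : ℕ} {Ω : Set (EuclideanSpace ℝ (Fin n))} {u : EuclideanSpace ℝ (Fin n) → ℝ}
  {f F : ℝ → ℝ} {x : EuclideanSpace ℝ (Fin n)}

lemma one_add_gradSq_pos : 0 < 1 + gradSq u x := by
  have : 0 ≤ gradSq u x := Finset.sum_nonneg fun i _ => sq_nonneg _
  linarith

lemma differentiableAt_sqrt (hp : ∀ l, DifferentiableAt ℝ (pd u l) x) :
    DifferentiableAt ℝ (fun y => √(1 + gradSq u y)) x := by
  have hg : DifferentiableAt ℝ (gradSq u) x :=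
    DifferentiableAt.fun_sum fun l _ => (hp l).pow 2
  exact (hg.const_add 1).sqrt one_add_gradSq_pos.ne'

lemma hasLineDerivAt_gradSq (hp : ∀ l, DifferentiableAt ℝ (pd u l) x) (k : Fin n) :
    HasLineDerivAt ℝ (gradSq u) (2 * ∑ l, pd u l x * pd (pd u l) k x) x (coordDir k) := by
  have := HasDerivAt.fun_sum (u := Finset.univ) fun l _ => (hasLineDerivAt_pd (hp l) k).pow 2
  refine this.congr_deriv ?_
  simp [Finset.mul_sum, mul_assoc]

lemma hasLineDerivAt_sqrt (hp : ∀ l, DifferentiableAt ℝ (pd u l) x) (k : Fin n) :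
    HasLineDerivAt ℝ (fun y => √(1 + gradSq u y))
      ((∑ l, pd u l x * pd (pd u l) k x) / √(1 + gradSq u x)) x (coordDir k) := by
  have h0 : 1 + gradSq u (x + (0 : ℝ) • coordDir k) ≠ 0 := one_add_gradSq_pos.ne'
  have := (HasDerivAt.const_add 1 (hasLineDerivAt_gradSq hp k)).sqrt h0
  refine this.congr_deriv ?_
  simp only [zero_smul, add_zero]
  rw [mul_div_mul_left _ _ two_ne_zero]

lemma sqrt_pos : 0 < √(1 + gradSq u x) := Real.sqrt_pos.2 one_add_gradSq_pos

lemma sqrt_line_ne_zero (k : Fin n) : √(1 + gradSq u (x + (0 : ℝ) • coordDir k)) ≠ 0 :=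
  sqrt_pos.ne'

lemma mcOp_eq (hp : ∀ l, DifferentiableAt ℝ (pd u l) x) :
    mcOp u x = (∑ i, pd (pd u i) i x) / √(1 + gradSq u x)
      - (∑ i, pd u i x * ∑ l, pd u l x * pd (pd u l) i x) / √(1 + gradSq u x) ^ 3 := by
  have hw := (sqrt_pos (u := u) (x := x)).ne'
  rw [mcOp, Finset.sum_div, Finset.sum_div, ← Finset.sum_sub_distrib]
  refine Finset.sum_congr rfl fun i _ => ?_
  have hd := differentiableAt_quotient (hp i) (differentiableAt_sqrt hp)
  refine pd_eq_of_hasLineDerivAt (hd hw) ?_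
  refine (HasDerivAt.div (hasLineDerivAt_pd (hp i) i) (hasLineDerivAt_sqrt hp i)
    (sqrt_line_ne_zero i)).congr_deriv ?_
  simp only [zero_smul, add_zero]
  field_simp

lemma pd_Pfun (hF : ∀ t, HasDerivAt F (f t) t) (hu : DifferentiableAt ℝ u x)
    (hp : ∀ l, DifferentiableAt ℝ (pd u l) x) (i : Fin n) :
    pd (Pfun F u) i x = f (u x) * pd u i x
      + (∑ k, pd u k x * pd (pd u k) i x) / √(1 + gradSq u x) ^ 3 := by
  have hw := (sqrt_pos (u := u) (x := x)).ne'
  have hd := differentiableAt_quotient (differentiableAt_const 1) (differentiableAt_sqrt hp)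
  refine pd_eq_of_hasLineDerivAt (((hF (u x)).differentiableAt.comp x hu).sub (hd hw)) ?_
  refine (((hF _).comp 0 (hasLineDerivAt_pd hu i)).sub ((hasDerivAt_const 0 1).div
    (hasLineDerivAt_sqrt hp i) (sqrt_line_ne_zero i))).congr_deriv ?_
  simp only [zero_smul, add_zero]
  field_simp
  ring

lemma hasLineDerivAt_hessian_mul_grad (hp : ∀ l, DifferentiableAt ℝ (pd u l) x)
    (hpp : ∀ l m, DifferentiableAt ℝ (pd (pd u l) m) x) (i j : Fin n) :
    HasLineDerivAt ℝ (fun y => ∑ k, pd u k y * pd (pd u k) i y)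
      (∑ k, (pd (pd u k) j x * pd (pd u k) i x + pd u k x * pd (pd (pd u k) i) j x)) x
      (coordDir j) := by
  refine (HasDerivAt.fun_sum (u := Finset.univ) fun k _ =>
    (hasLineDerivAt_pd (hp k) j).mul (hasLineDerivAt_pd (hpp k i) j)).congr_deriv ?_
  simp

lemma differentiableAt_hessian_mul_grad (hp : ∀ l, DifferentiableAt ℝ (pd u l) x)
    (hpp : ∀ l m, DifferentiableAt ℝ (pd (pd u l) m) x) (i : Fin n) :
    DifferentiableAt ℝ (fun y => ∑ k, pd u k y * pd (pd u k) i y) x :=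
  DifferentiableAt.fun_sum fun k _ => (hp k).mul (hpp k i)

lemma hasLineDerivAt_comp {f : ℝ → ℝ} (hf : Differentiable ℝ f) (hu : DifferentiableAt ℝ u x)
    (j : Fin n) :
    HasLineDerivAt ℝ (fun y => f (u y)) (deriv f (u x) * pd u j x) x (coordDir j) := by
  refine ((hf _).hasDerivAt.comp 0 (hasLineDerivAt_pd hu j)).congr_deriv ?_
  simp

lemma pd_pd_Pfun (hΩ : IsOpen Ω) (hF : ∀ t, HasDerivAt F (f t) t) (hf : Differentiable ℝ f)
    (hu : ∀ y ∈ Ω, DifferentiableAt ℝ u y) (hp : ∀ l, ∀ y ∈ Ω, DifferentiableAt ℝ (pd u l) y)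
    (hpp : ∀ l m, ∀ y ∈ Ω, DifferentiableAt ℝ (pd (pd u l) m) y) (hx : x ∈ Ω) (i j : Fin n) :
    pd (pd (Pfun F u) i) j x = deriv f (u x) * pd u i x * pd u j x + f (u x) * pd (pd u i) j x
      + (∑ k, (pd (pd u k) j x * pd (pd u k) i x + pd u k x * pd (pd (pd u k) i) j x))
        / √(1 + gradSq u x) ^ 3
      - 3 * (∑ k, pd u k x * pd (pd u k) i x) * (∑ k, pd u k x * pd (pd u k) j x)
        / √(1 + gradSq u x) ^ 5 := by
  have hw := (sqrt_pos (u := u) (x := x)).ne'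
  have hev : pd (Pfun F u) i =ᶠ[nhds x] fun y => f (u y) * pd u i y
      + (∑ k, pd u k y * pd (pd u k) i y) / √(1 + gradSq u y) ^ 3 := by
    filter_upwards [hΩ.mem_nhds hx] with y hy
    exact pd_Pfun hF (hu y hy) (fun l => hp l y hy) i
  have hpx := fun l => hp l x hx
  have hppx := fun l m => hpp l m x hx
  rw [pd_congr hev]
  have hd := differentiableAt_quotient (differentiableAt_hessian_mul_grad hpx hppx i)
    ((differentiableAt_sqrt hpx).fun_pow 3)
  refine pd_eq_of_hasLineDerivAt ((((hf _).comp x (hu x hx)).mul (hpx i)).add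
    (hd (pow_ne_zero 3 hw))) ?_
  refine (((hasLineDerivAt_comp hf (hu x hx) j).mul (hasLineDerivAt_pd (hpx i) j)).add
    (HasDerivAt.div (hasLineDerivAt_hessian_mul_grad hpx hppx i j)
      ((hasLineDerivAt_sqrt hpx j).pow 3)
      (pow_ne_zero 3 (sqrt_line_ne_zero j)))).congr_deriv ?_
  simp only [zero_smul, add_zero, Pi.pow_apply]
  field_simp
  push_cast
  ring

lemma expanded_equation (hp : ∀ l, DifferentiableAt ℝ (pd u l) x)
    (hPDE : mcOp u x + f (u x) = 0) :
    √(1 + gradSq u x) ^ 2 * ∑ i, pd (pd u i) i x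
      - ∑ i, pd u i x * ∑ l, pd u l x * pd (pd u l) i x + f (u x) * √(1 + gradSq u x) ^ 3 = 0 := by
  have hw := (sqrt_pos (u := u) (x := x)).ne'
  rw [mcOp_eq hp] at hPDE
  field_simp at hPDE
  linarith

lemma differentiated_equation (hΩ : IsOpen Ω) (hf : Differentiable ℝ f)
    (hu : ∀ y ∈ Ω, DifferentiableAt ℝ u y) (hp : ∀ l, ∀ y ∈ Ω, DifferentiableAt ℝ (pd u l) y)
    (hpp : ∀ l m, ∀ y ∈ Ω, DifferentiableAt ℝ (pd (pd u l) m) y)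
    (hPDE : ∀ y ∈ Ω, mcOp u y + f (u y) = 0) (hx : x ∈ Ω) (k : Fin n) :
    2 * (∑ l, pd u l x * pd (pd u l) k x) * ∑ i, pd (pd u i) i x
      + √(1 + gradSq u x) ^ 2 * ∑ i, pd (pd (pd u i) i) k x
      - ∑ i, (pd (pd u i) k x * (∑ l, pd u l x * pd (pd u l) i x)
        + pd u i x * ∑ l, (pd (pd u l) k x * pd (pd u l) i x + pd u l x * pd (pd (pd u l) i) k x))
      + (deriv f (u x) * pd u k x * √(1 + gradSq u x) ^ 3
        + f (u x) * (3 * √(1 + gradSq u x) * ∑ l, pd u l x * pd (pd u l) k x)) = 0 := by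
  have hw := (sqrt_pos (u := u) (x := x)).ne'
  have hpx := fun l => hp l x hx
  have hppx := fun l m => hpp l m x hx
  have hev : (fun y => √(1 + gradSq u y) ^ 2 * ∑ i, pd (pd u i) i y
      - ∑ i, pd u i y * ∑ l, pd u l y * pd (pd u l) i y + f (u y) * √(1 + gradSq u y) ^ 3)
      =ᶠ[nhds x] fun _ => 0 := by
    filter_upwards [hΩ.mem_nhds hx] with y hy
    exact expanded_equation (fun l => hp l y hy) (hPDE y hy)
  have hzero : pd (fun _ : EuclideanSpace ℝ (Fin n) => (0 : ℝ)) k x = 0 := by simp [pd]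
  rw [← hzero, ← pd_congr hev]
  refine (pd_eq_of_hasLineDerivAt (hev.differentiableAt_iff.2 (differentiableAt_const 0)) ?_).symm
  refine (((HasDerivAt.mul ((hasLineDerivAt_sqrt hpx k).pow 2)
      (HasDerivAt.fun_sum (u := Finset.univ) fun i _ => hasLineDerivAt_pd (hppx i i) k)).sub
    (HasDerivAt.fun_sum (u := Finset.univ) fun i _ => (hasLineDerivAt_pd (hpx i) k).mul
      (hasLineDerivAt_hessian_mul_grad hpx hppx i k))).add
    ((hasLineDerivAt_comp hf (hu x hx) k).mul ((hasLineDerivAt_sqrt hpx k).pow 3))).congr_deriv ?_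
  simp only [zero_smul, add_zero, Pi.pow_apply]
  field_simp
  push_cast
  ring

end PFunction

/-- the P-function satisfies the elliptic differential inequality
`(1+|∇u|²)ΔP - u_i u_j P_{ij} + b^i P_i ≥ 0` away from critical points of `u`,
where `b^i = (1+|∇u|²)^{1/2}(1+|∇u|²+|∇u|^{-2}) f(u) u_i + (1-|∇u|^{-2}) u_j u_{ij}`. -/
theorem statement2 {n : ℕ} (Ω : Set (EuclideanSpace ℝ (Fin n))) (hΩ : IsOpen Ω)
    (u : EuclideanSpace ℝ (Fin n) → ℝ) (f F : ℝ → ℝ)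
    (hu : ContDiffOn ℝ 3 u Ω) (hf : ContDiff ℝ 1 f)
    (hF : ∀ t, HasDerivAt F (f t) t)
    (hPDE : ∀ y ∈ Ω, mcOp u y + f (u y) = 0) :
    ∀ x ∈ Ω, gradSq u x ≠ 0 →
      0 ≤ (1 + gradSq u x) * (∑ i, pd (pd (Pfun F u) i) i x)
          - (∑ i, ∑ j, pd u i x * pd u j x * pd (pd (Pfun F u) i) j x)
          + ∑ i, (Real.sqrt (1 + gradSq u x) * (1 + gradSq u x + (gradSq u x)⁻¹)
                    * f (u x) * pd u i x
                  + (1 - (gradSq u x)⁻¹) * ∑ j, pd u j x * pd (pd u i) j x)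
                * pd (Pfun F u) i x := by
  intro x hx hq
  have hp2 (l : Fin n) : ContDiffOn ℝ 2 (pd u l) Ω := contDiffOn_pd hΩ hu (by norm_num) l
  have hpp1 (l m : Fin n) : ContDiffOn ℝ 1 (pd (pd u l) m) Ω :=
    contDiffOn_pd hΩ (hp2 l) (by norm_num) m
  have hud (y) (hy : y ∈ Ω) : DifferentiableAt ℝ u y :=
    (hu.differentiableOn (by norm_num)).differentiableAt (hΩ.mem_nhds hy)
  have hpd (l) (y) (hy : y ∈ Ω) : DifferentiableAt ℝ (pd u l) y :=
    ((hp2 l).differentiableOn (by norm_num)).differentiableAt (hΩ.mem_nhds hy)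
  have hppd (l m) (y) (hy : y ∈ Ω) : DifferentiableAt ℝ (pd (pd u l) m) y :=
    ((hpp1 l m).differentiableOn (by norm_num)).differentiableAt (hΩ.mem_nhds hy)
  have hfd : Differentiable ℝ f := hf.differentiable (by norm_num)
  have hu2 : ContDiffOn ℝ 2 u Ω := hu.of_le (by norm_num)
  have hw2 : √(1 + gradSq u x) ^ 2 = 1 + gradSq u x := Real.sq_sqrt one_add_gradSq_pos.le
  have hT₁ (i j k : Fin n) : pd (pd (pd u i) j) k x = pd (pd (pd u j) i) k x :=
    pd_congr (Filter.eventually_of_mem (hΩ.mem_nhds hx) fun y hy => pd_comm hΩ hu2 hy)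
  have key := elliptic_inequality_of_derivatives (p := fun i => pd u i x)
    (H := fun i j => pd (pd u i) j x) (T := fun i j k => pd (pd (pd u i) j) k x)
    (sqrt_pos (u := u) (x := x)) hw2 hq (fun i j => pd_comm hΩ hu2 hx) hT₁
    (fun i j k => pd_comm hΩ (hp2 i) hx)
    (expanded_equation (fun l => hpd l x hx) (hPDE x hx))
    (differentiated_equation hΩ hfd hud hpd hppd hPDE hx)
  simp_rw [pd_pd_Pfun hΩ hF hfd hud hpd hppd hx,
    fun i => pd_Pfun hF (hud x hx) (fun l => hpd l x hx) i]
  simp only [hw2] at key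
  exact key
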